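/- Let {x_k}, {z_k} be generated by the mirror descent iteration z_{k+1} = z_k − σ s ∇f(x_k), x_{k+1} = ∇φ*(z_{k+1}), with initialization ∇φ*(z₀) = x₀. If the step size satisfies 0 < s ≤ 1/L, then min_{0 ≤ i ≤ k} ‖x_{i+1} − x_i‖² = o(1/k²) as k → ∞; that is, k² · min_{0 ≤ i ≤ k} ‖x_{i+1} − x_i‖² → 0. -/

import Mathlib

open Set Filter Topology
open scoped RealInnerProductSpace

/-- The Fenchel conjugate of a function on Euclidean space. -/
noncomputable def fenchelConj {n : ℕ} (φ : EuclideanSpace ℝ (Fin n) → ℝ)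
    (z : EuclideanSpace ℝ (Fin n)) : ℝ :=
  ⨆ x : EuclideanSpace ℝ (Fin n), (⟪z, x⟫ - φ x)

section Calculus

variable {E : Type*} [NormedAddCommGroup E] [InnerProductSpace ℝ E] [CompleteSpace E]

lemma HasGradientAt.hasDerivAt_line {f : E → ℝ} {g x d : E} {t : ℝ}
    (h : HasGradientAt f g (x + t • d)) :
    HasDerivAt (fun r : ℝ => f (x + r • d)) ⟪g, d⟫ t := by
  have hline : HasDerivAt (fun r : ℝ => x + r • d) d t := by
    simpa using ((hasDerivAt_id t).smul_const d).const_add x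
  exact h.hasFDerivAt.comp_hasDerivAt t hline

lemma ConvexOn.add_inner_gradient_le {f : E → ℝ} (hf : ConvexOn ℝ univ f) {g x : E}
    (hg : HasGradientAt f g x) (y : E) : f x + ⟪g, y - x⟫ ≤ f y := by
  have hconv : ConvexOn ℝ univ (fun r : ℝ => f (x + r • (y - x))) := by
    have := hf.comp_affineMap (AffineMap.lineMap (k := ℝ) x y)
    simpa [Function.comp_def, AffineMap.lineMap_apply, add_comm] using this
  have hd : HasDerivAt (fun r : ℝ => f (x + r • (y - x))) ⟪g, y - x⟫ 0 :=
    HasGradientAt.hasDerivAt_line (by simpa using hg)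
  have := hconv.le_slope_of_hasDerivAt (mem_univ 0) (mem_univ 1) one_pos hd
  simp [slope_def_field] at this
  linarith

lemma le_add_inner_gradient_add_sq {f : E → ℝ} {f' : E → E} {L : ℝ}
    (hf : ∀ x, HasGradientAt f (f' x) x) (hL : ∀ x y, ‖f' x - f' y‖ ≤ L * ‖x - y‖) (x y : E) :
    f y ≤ f x + ⟪f' x, y - x⟫ + L / 2 * ‖y - x‖ ^ 2 := by
  set d := y - x with hd
  have hderiv (t : ℝ) : HasDerivAt
      (fun r : ℝ => f (x + r • d) - r * ⟪f' x, d⟫ - L / 2 * ‖d‖ ^ 2 * r ^ 2)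
      (⟪f' (x + t • d), d⟫ - ⟪f' x, d⟫ - L * ‖d‖ ^ 2 * t) t := by
    have h1 := (hf (x + t • d)).hasDerivAt_line
    have h2 := (hasDerivAt_id t).mul_const ⟪f' x, d⟫
    have h3 := (hasDerivAt_pow 2 t).const_mul (L / 2 * ‖d‖ ^ 2)
    refine ((h1.sub h2).sub h3).congr_deriv ?_
    push_cast
    ring
  have hanti : AntitoneOn
      (fun r : ℝ => f (x + r • d) - r * ⟪f' x, d⟫ - L / 2 * ‖d‖ ^ 2 * r ^ 2) (Ici 0) := by
    refine antitoneOn_of_deriv_nonpos (convex_Ici 0)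
      (fun t _ => (hderiv t).continuousAt.continuousWithinAt)
      (fun t _ => (hderiv t).differentiableAt.differentiableWithinAt) fun t ht => ?_
    rw [interior_Ici, mem_Ioi] at ht
    rw [(hderiv t).deriv, ← inner_sub_left]
    have h1 := real_inner_le_norm (f' (x + t • d) - f' x) d
    have h2 := hL (x + t • d) x
    rw [add_sub_cancel_left, norm_smul, Real.norm_of_nonneg ht.le] at h2
    have h3 := mul_le_mul_of_nonneg_right h2 (norm_nonneg d)
    nlinarith
  have := hanti (mem_Ici.2 le_rfl) (mem_Ici.2 zero_le_one) zero_le_one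
  simp [hd] at this
  linarith

end Calculus

section StrongConvexity

variable {E : Type*} [NormedAddCommGroup E]

lemma StrongConvexOn.add_sq_le_of_forall_le [NormedSpace ℝ E] {ψ : E → ℝ} {σ : ℝ}
    (hψ : StrongConvexOn univ σ ψ) {p : E} (hp : ∀ y, ψ p ≤ ψ y) (y : E) :
    ψ p + σ / 2 * ‖y - p‖ ^ 2 ≤ ψ y := by
  have key : ∀ t ∈ Ioo (0 : ℝ) 1, (1 - t) * (σ / 2 * ‖y - p‖ ^ 2) ≤ ψ y - ψ p := by
    rintro t ⟨h0, h1⟩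
    have h := hψ.2 (mem_univ y) (mem_univ p) h0.le (sub_nonneg.2 h1.le) (by ring)
    have h' := hp (t • y + (1 - t) • p)
    simp only [smul_eq_mul] at h
    refine le_of_mul_le_mul_left ?_ h0
    linarith
  have hlim : Tendsto (fun t : ℝ => (1 - t) * (σ / 2 * ‖y - p‖ ^ 2)) (𝓝[>] 0)
      (𝓝 ((1 - 0) * (σ / 2 * ‖y - p‖ ^ 2))) :=
    (Continuous.tendsto (by fun_prop) 0).mono_left nhdsWithin_le_nhds
  have := le_of_tendsto hlim (Filter.mem_of_superset (Ioo_mem_nhdsGT one_pos) key)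
  linarith

lemma StrongConvexOn.exists_forall_le [NormedSpace ℝ E] [FiniteDimensional ℝ E] {ψ : E → ℝ}
    {σ : ℝ} (hσ : 0 < σ) (hψ : StrongConvexOn univ σ ψ) : ∃ p, ∀ y, ψ p ≤ ψ y := by
  have : ProperSpace E := FiniteDimensional.proper ℝ E
  have hcont : Continuous ψ :=
    continuousOn_univ.1 ((hψ.strictConvexOn hσ).convexOn.continuousOn isOpen_univ)
  obtain ⟨q, -, hq⟩ := (isCompact_closedBall (0 : E) 1).exists_isMinOn
    ⟨0, by simp⟩ hcont.continuousOn
  refine hcont.exists_forall_le' 0 ?_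
  filter_upwards [(tendsto_norm_cocompact_atTop (E := E)).eventually_ge_atTop
    (1 + 2 * (ψ 0 - ψ q) / σ)] with y hy
  have hq0 : ψ q ≤ ψ 0 := hq (by simp)
  have hR : 0 ≤ 2 * (ψ 0 - ψ q) / σ := by
    have := sub_nonneg.2 hq0
    positivity
  have hN : 1 ≤ ‖y‖ := by linarith
  have hN0 : 0 < ‖y‖ := by linarith
  have h := hψ.2 (mem_univ y) (mem_univ 0) (inv_nonneg.2 hN0.le)
    (sub_nonneg.2 (inv_le_one_of_one_le₀ hN)) (by ring)
  have hqy : ψ q ≤ ψ (‖y‖⁻¹ • y + (1 - ‖y‖⁻¹) • (0 : E)) := hq (by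
    simp [norm_smul, hN0.ne'])
  simp only [smul_eq_mul, sub_zero] at h
  have h1 := mul_le_mul_of_nonneg_left (hqy.trans h) hN0.le
  have h2 : ‖y‖ * (‖y‖⁻¹ * ψ y + (1 - ‖y‖⁻¹) * ψ 0
      - ‖y‖⁻¹ * (1 - ‖y‖⁻¹) * (σ / 2 * ‖y‖ ^ 2))
      = ψ y + (‖y‖ - 1) * ψ 0 - σ / 2 * (‖y‖ - 1) * ‖y‖ := by
    field_simp
  rw [h2] at h1
  have h3 : 2 * (ψ 0 - ψ q) ≤ (‖y‖ - 1) * σ := by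
    rw [← div_le_iff₀ hσ]
    linarith
  have h4 := mul_le_mul_of_nonneg_right h3 hN0.le
  linarith

lemma StrongConvexOn.sub_inner [InnerProductSpace ℝ E] {φ : E → ℝ} {σ : ℝ}
    (hφ : StrongConvexOn univ σ φ) (z : E) :
    StrongConvexOn univ σ (fun y => φ y - ⟪z, y⟫) := by
  refine ⟨convex_univ, fun u hu v hv a b ha hb hab => ?_⟩
  have h := hφ.2 hu hv ha hb hab
  simp only [inner_add_right, inner_smul_right, smul_eq_mul] at h ⊢
  linarith

end StrongConvexity

section Conjugate

variable {n : ℕ} {φ : EuclideanSpace ℝ (Fin n) → ℝ} {σ : ℝ}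

lemma inner_sub_le_fenchelConj (hσ : 0 < σ) (hφ : StrongConvexOn univ σ φ)
    (z y : EuclideanSpace ℝ (Fin n)) : ⟪z, y⟫ - φ y ≤ fenchelConj φ z := by
  obtain ⟨p, hp⟩ := (hφ.sub_inner z).exists_forall_le hσ
  refine le_ciSup (f := fun y => ⟪z, y⟫ - φ y) ⟨⟪z, p⟫ - φ p, ?_⟩ y
  rintro _ ⟨w, rfl⟩
  have := hp w
  dsimp only at this ⊢
  linarith

lemma fenchelConj_eq_of_hasGradientAt (hσ : 0 < σ) (hφ : StrongConvexOn univ σ φ)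
    {z g : EuclideanSpace ℝ (Fin n)} (hg : HasGradientAt (fenchelConj φ) g z) :
    fenchelConj φ z = ⟪z, g⟫ - φ g := by
  obtain ⟨p, hp⟩ := (hφ.sub_inner z).exists_forall_le hσ
  have hle : fenchelConj φ z ≤ ⟪z, p⟫ - φ p := ciSup_le fun w => by
    have := hp w
    linarith
  have hmin : IsLocalMin (fun w => fenchelConj φ w - ⟪p, w⟫) z :=
    Filter.Eventually.of_forall fun w => by
      have := inner_sub_le_fenchelConj hσ hφ w p
      have := real_inner_comm w p
      have := real_inner_comm z p
      dsimp only
      linarith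
  have hder : HasFDerivAt (fun w => fenchelConj φ w - ⟪p, w⟫)
      (InnerProductSpace.toDual ℝ _ g - innerSL ℝ p) z :=
    hg.hasFDerivAt.sub (innerSL ℝ p).hasFDerivAt
  have hgp : g = p := by
    refine ext_inner_right ℝ fun v => ?_
    have := DFunLike.congr_fun (hmin.hasFDerivAt_eq_zero hder) v
    simpa [sub_eq_zero] using this
  rw [hgp]
  exact le_antisymm hle (inner_sub_le_fenchelConj hσ hφ z p)

/-- The Bregman divergence of the conjugate of a `σ`-strongly convex function dominates the
squared distance of the gradients. -/
lemma fenchelConj_add_inner_add_sq_le (hσ : 0 < σ) (hφ : StrongConvexOn univ σ φ)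
    {z w gz gw : EuclideanSpace ℝ (Fin n)} (hz : HasGradientAt (fenchelConj φ) gz z)
    (hw : HasGradientAt (fenchelConj φ) gw w) :
    fenchelConj φ z + ⟪gz, w - z⟫ + σ / 2 * ‖gz - gw‖ ^ 2 ≤ fenchelConj φ w := by
  have hz' := fenchelConj_eq_of_hasGradientAt hσ hφ hz
  have hw' := fenchelConj_eq_of_hasGradientAt hσ hφ hw
  have h := (hφ.sub_inner w).add_sq_le_of_forall_le (p := gw) (fun y => by
    have := inner_sub_le_fenchelConj hσ hφ w y
    linarith) gz
  rw [inner_sub_right, real_inner_comm w gz, real_inner_comm z gz]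
  linarith

end Conjugate

section Lyapunov

lemma tendsto_sq_mul_of_lyapunov {W a m : ℕ → ℝ} {c : ℝ} (hc : 0 < c)
    (hW : ∀ k, 0 ≤ W k) (hstep : ∀ k : ℕ, W (k + 1) + c * (k * a k) ≤ W k)
    (hm : ∀ k, 0 ≤ m k) (hma : ∀ k, ∀ i ≤ k, m k ≤ a i) :
    Tendsto (fun k : ℕ => (k : ℝ) ^ 2 * m k) atTop (𝓝 0) := by
  have ha (i : ℕ) : 0 ≤ a i := (hm i).trans (hma i i le_rfl)
  have hanti : Antitone W := antitone_nat_of_succ_le fun k => by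
    have : 0 ≤ c * (k * a k) := mul_nonneg hc.le (mul_nonneg k.cast_nonneg (ha k))
    linarith [hstep k]
  have hlim := tendsto_atTop_ciInf hanti ⟨0, by rintro _ ⟨k, rfl⟩; exact hW k⟩
  have hsum (k j r : ℕ) (h : j + r ≤ k + 1) : W (j + r) + c * (r * (j * m k)) ≤ W j := by
    induction r with
    | zero => simp
    | succ r ih =>
      have h1 := ih (by omega)
      have h2 := hstep (j + r)
      have h3 : (j : ℝ) * m k ≤ ((j + r : ℕ) : ℝ) * a (j + r) :=
        mul_le_mul (by exact_mod_cast Nat.le_add_right j r) (hma k _ (by omega)) (hm k)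
          (Nat.cast_nonneg _)
      have h4 := mul_le_mul_of_nonneg_left h3 hc.le
      rw [← add_assoc j r 1]
      push_cast at h4 h2 ⊢
      linarith
  have hhalf : Tendsto (fun k : ℕ => (k + 1) / 2) atTop atTop :=
    tendsto_atTop.2 fun b => by
      filter_upwards [eventually_ge_atTop (2 * b)] with k hk
      omega
  have hdouble : Tendsto (fun k : ℕ => (k + 1) / 2 + (k + 1) / 2) atTop atTop :=
    hhalf.atTop_add_atTop hhalf
  have hbound : Tendsto
      (fun k : ℕ => 4 / c * (W ((k + 1) / 2) - W ((k + 1) / 2 + (k + 1) / 2))) atTop (𝓝 0) := by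
    simpa using ((hlim.comp hhalf).sub (hlim.comp hdouble)).const_mul (4 / c)
  refine squeeze_zero (fun k => mul_nonneg (sq_nonneg _) (hm k)) (fun k => ?_) hbound
  have h1 := hsum k ((k + 1) / 2) ((k + 1) / 2) (by omega)
  have h2 : (k : ℝ) ≤ 2 * (((k + 1) / 2 : ℕ) : ℝ) := by
    exact_mod_cast (by omega : k ≤ 2 * ((k + 1) / 2))
  have h3 := mul_le_mul_of_nonneg_right (pow_le_pow_left₀ k.cast_nonneg h2 2) (hm k)
  have h4 : c * ((k : ℝ) ^ 2 * m k) ≤ 4 * (W ((k + 1) / 2) - W ((k + 1) / 2 + (k + 1) / 2)) := by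
    have := mul_le_mul_of_nonneg_left h3 hc.le
    linarith
  rw [div_mul_eq_mul_div, le_div_iff₀ hc]
  linarith

end Lyapunov

/-- Discrete mirror descent with step size `0 < s ≤ 1/L` satisfies
`min_{0 ≤ i ≤ k} ‖x_{i+1} − x_i‖² = o(1/k²)` as `k → ∞`. -/
theorem mirror_descent_displacement_rate
{n : ℕ} (f φ : EuclideanSpace ℝ (Fin n) → ℝ)
    (f' gφs : EuclideanSpace ℝ (Fin n) → EuclideanSpace ℝ (Fin n))
    (σ L s : ℝ) (hσ : 0 < σ)
    -- f is convex and differentiable with L-Lipschitz gradient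
    (hfconv : ConvexOn ℝ Set.univ f)
    (hfd : ∀ x, HasGradientAt f (f' x) x)
    (hfL : ∀ x y, ‖f' x - f' y‖ ≤ L * ‖x - y‖)
    -- φ is σ-strongly convex
    (hφsc : StrongConvexOn Set.univ σ φ)
    -- φ* is differentiable with gradient gφs
    (hgφs : ∀ z, HasGradientAt (fenchelConj φ) (gφs z) z)
    -- the mirror descent iteration
    (x z : ℕ → EuclideanSpace ℝ (Fin n))
    (hz : ∀ k : ℕ, z (k + 1) = z k - (σ * s) • f' (x k))
    (hx : ∀ k : ℕ, x (k + 1) = gφs (z (k + 1)))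
    (hx0 : gφs (z 0) = x 0)
    -- x* is a global minimizer of f and ∇φ*(z*) = x*
    (xs zs : EuclideanSpace ℝ (Fin n))
    (hxs : ∀ w, f xs ≤ f w) (hzs : gφs zs = xs)
    (hs : 0 < s) (hsL : s ≤ 1 / L) :
    Tendsto
      (fun k : ℕ => (k : ℝ) ^ 2 * sInf ((fun i => ‖x (i + 1) - x i‖ ^ 2) '' {i : ℕ | i ≤ k}))
      atTop (𝓝 0) := by
  have hL : 0 < L := one_div_pos.1 (hs.trans_le hsL)
  have hsL' : s * L ≤ 1 := (le_div_iff₀ hL).1 hsL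
  have hxz (k : ℕ) : HasGradientAt (fenchelConj φ) (x k) (z k) := by
    cases k with
    | zero => exact hx0 ▸ hgφs _
    | succ k => exact hx k ▸ hgφs _
  have hxszs : HasGradientAt (fenchelConj φ) xs zs := hzs ▸ hgφs zs
  have hstep (k : ℕ) : z (k + 1) - z k = -((σ * s) • f' (x k)) := by rw [hz]; abel
  set V : ℕ → ℝ := fun k => fenchelConj φ (z k) - fenchelConj φ zs - ⟪xs, z k - zs⟫ with hV
  set u : ℕ → ℝ := fun k => f (x k) - f xs with hu
  set a : ℕ → ℝ := fun k => ‖x (k + 1) - x k‖ ^ 2 with ha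
  have ha0 (k : ℕ) : 0 ≤ a k := sq_nonneg _
  have hu0 (k : ℕ) : 0 ≤ u k := sub_nonneg.2 (hxs _)
  have hV0 (k : ℕ) : 0 ≤ V k := by
    have h := fenchelConj_add_inner_add_sq_le hσ hφsc hxszs (hxz k)
    have : 0 ≤ σ / 2 * ‖xs - x k‖ ^ 2 := by positivity
    simp only [hV]
    linarith
  have hdesc (k : ℕ) : f (x (k + 1)) ≤ f (x k) + ⟪f' (x k), x (k + 1) - x k⟫ + L / 2 * a k :=
    le_add_inner_gradient_add_sq hfd hfL _ _
  have hback (k : ℕ) : fenchelConj φ (z (k + 1)) + σ * s * ⟪f' (x k), x (k + 1)⟫ + σ / 2 * a k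
      ≤ fenchelConj φ (z k) := by
    have h := fenchelConj_add_inner_add_sq_le hσ hφsc (hxz (k + 1)) (hxz k)
    rwa [← neg_sub (z (k + 1)), hstep, neg_neg, inner_smul_right, real_inner_comm] at h
  have hforw (k : ℕ) : fenchelConj φ (z k) - σ * s * ⟪f' (x k), x k⟫ + σ / 2 * a k
      ≤ fenchelConj φ (z (k + 1)) := by
    have h := fenchelConj_add_inner_add_sq_le hσ hφsc (hxz k) (hxz (k + 1))
    rwa [hstep, inner_neg_right, inner_smul_right, real_inner_comm, norm_sub_rev,
      ← sub_eq_add_neg] at h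
  have hsLa (k : ℕ) : σ * (s * L) * a k ≤ σ * 1 * a k :=
    mul_le_mul_of_nonneg_right (mul_le_mul_of_nonneg_left hsL' hσ.le) (ha0 k)
  have hσs : 0 < σ * s := mul_pos hσ hs
  have hu_step (k : ℕ) : σ * s * u (k + 1) + σ / 2 * a k ≤ σ * s * u k := by
    have h1 := mul_le_mul_of_nonneg_left (hdesc k) hσs.le
    have h2 := hback k
    have h3 := hforw k
    have h4 := hsLa k
    rw [inner_sub_right] at h1
    simp only [hu]
    linarith
  have hV_step (k : ℕ) : V (k + 1) + σ * s * u (k + 1) ≤ V k := by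
    have h1 := mul_le_mul_of_nonneg_left (hdesc k) hσs.le
    have h2 := hback k
    have h3 := mul_le_mul_of_nonneg_left (hfconv.add_inner_gradient_le (hfd (x k)) xs) hσs.le
    have h4 := hsLa k
    have h5 : ⟪xs, z (k + 1) - zs⟫ = ⟪xs, z k - zs⟫ - σ * s * ⟪f' (x k), xs⟫ := by
      rw [← sub_add_sub_cancel (z (k + 1)) (z k) zs, hstep, inner_add_right, inner_neg_right,
        inner_smul_right, real_inner_comm]
      ring
    rw [inner_sub_right] at h1 h3
    simp only [hu, hV]
    rw [h5]
    linarith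
  have hne (k : ℕ) : (a '' {i : ℕ | i ≤ k}).Nonempty := ⟨a 0, 0, Nat.zero_le k, rfl⟩
  have hlb (k : ℕ) : 0 ∈ lowerBounds (a '' {i : ℕ | i ≤ k}) := by
    rintro _ ⟨i, -, rfl⟩
    exact ha0 i
  refine tendsto_sq_mul_of_lyapunov (W := fun k => V k + k * (σ * s * u k)) (a := a)
    (half_pos hσ) (fun k => ?_) (fun k => ?_) (fun k => le_csInf (hne k) (hlb k))
    (fun k i hi => csInf_le ⟨0, hlb k⟩ ⟨i, hi, rfl⟩)
  · exact add_nonneg (hV0 k) (mul_nonneg k.cast_nonneg (mul_nonneg hσs.le (hu0 k)))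
  · have h1 := mul_le_mul_of_nonneg_left (hu_step k) k.cast_nonneg
    have h2 := hV_step k
    push_cast
    linarith
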